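/- For every n ≥ 1 there exist constants ν₀ > 0 and C_n > 0, depending only on n, such that for all ν ≥ ν₀ and all μ = (μ_a)_{a ≠ 0ⁿ} ∈ ℝ^{4ⁿ−1} with |μ_a| ≤ 1 for all a, the map μ' ↦ E(μ', ν) is differentiable at μ, and its Jacobian matrix J(μ,ν) = ∂E(μ,ν)/∂μ (an (n·6ⁿ) × (4ⁿ−1) real matrix) satisfies ‖J(μ,ν) v‖ ≥ (2^{n/2} − C_n/ν) ‖v‖ for every v ∈ ℝ^{4ⁿ−1}; i.e., the smallest singular value of J(μ,ν) is at least 2^{n/2} − C_n/ν. -/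

import Mathlib

open Matrix

noncomputable def specNorm {n : Type*} [Fintype n] [DecidableEq n] (A : Matrix n n ℂ) : ℝ :=
  ‖Matrix.toEuclideanCLM (𝕜 := ℂ) A‖

noncomputable def kthSmallest {ι : Type*} [Fintype ι] (f : ι → ℝ) (k : ℕ) : ℝ :=
  ((Finset.univ.val.map f).sort (· ≤ ·)).getD k 0

noncomputable def euclNorm {ι : Type*} [Fintype ι] (v : ι → ℂ) : ℝ :=
  ‖((WithLp.equiv 2 (ι → ℂ)).symm v : EuclideanSpace ℂ ι)‖
/-- The Pauli matrices. -/
noncomputable def pauli : Fin 4 → Matrix (Fin 2) (Fin 2) ℂ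
  | 0 => 1
  | 1 => !![0, 1; 1, 0]
  | 2 => !![0, -Complex.I; Complex.I, 0]
  | 3 => !![1, 0; 0, -1]

/-- The Pauli string σ^a on n qubits. -/
noncomputable def pauliString {n : ℕ} (a : Fin n → Fin 4) :
    Matrix (Fin n → Fin 2) (Fin n → Fin 2) ℂ :=
  fun x y => ∏ j, pauli (a j) (x j) (y j)

/-- Index set for nontrivial Pauli strings. -/
abbrev PIdx (n : ℕ) := {a : Fin n → Fin 4 // a ≠ fun _ => 0}

/-- The unknown Hamiltonian H(μ). -/
noncomputable def Hmat {n : ℕ} (lam : PIdx n → ℝ) :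
    Matrix (Fin n → Fin 2) (Fin n → Fin 2) ℂ :=
  ∑ a : PIdx n, (lam a : ℂ) • pauliString a.val

/-- σ^(β+1) acting on the j-th qubit. -/
noncomputable def pauliAt {n : ℕ} (j : Fin n) (b : Fin 3) :
    Matrix (Fin n → Fin 2) (Fin n → Fin 2) ℂ :=
  pauliString (fun i => if i = j then b.succ else 0)

/-- The control Hamiltonian. -/
noncomputable def Hctrl {n : ℕ} (k : Fin n) (s : Fin n → Fin 2) (β : Fin n → Fin 3) :
    Matrix (Fin n → Fin 2) (Fin n → Fin 2) ℂ :=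
  (∑ j ∈ Finset.univ.erase k, ((-1 : ℂ) ^ (s j : ℕ)) • pauliAt j (β j))
    + (((-1 : ℂ) ^ (s k : ℕ)) / 2) • pauliAt k (β k)

/-- The total Hamiltonian. -/
noncomputable def Htot {n : ℕ} (lam : PIdx n → ℝ) (ν : ℝ) (k : Fin n) (s : Fin n → Fin 2)
    (β : Fin n → Fin 3) : Matrix (Fin n → Fin 2) (Fin n → Fin 2) ℂ :=
  Hmat lam - (ν : ℂ) • Hctrl k s β

open Classical in
/-- The gap between the two smallest eigenvalues of H_tot. -/
noncomputable def Egap {n : ℕ} (lam : PIdx n → ℝ) (ν : ℝ) (k : Fin n) (s : Fin n → Fin 2)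
    (β : Fin n → Fin 3) : ℝ :=
  if h : (Htot lam ν k s β).IsHermitian then
    kthSmallest h.eigenvalues 1 - kthSmallest h.eigenvalues 0
  else 0

abbrev EIdx (n : ℕ) := Fin n × (Fin n → Fin 2) × (Fin n → Fin 3)

/-- The vector of all gaps, in ℝ^{n·6^n}. -/
noncomputable def EvecE {n : ℕ} (μ : EuclideanSpace ℝ (PIdx n)) (ν : ℝ) :
    EuclideanSpace ℝ (EIdx n) :=
  (WithLp.equiv 2 _).symm (fun p => Egap ((WithLp.equiv 2 _) μ) ν p.1 p.2.1 p.2.2)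

/-- The least-squares loss. -/
noncomputable def Lloss {n : ℕ} (Ehat : EuclideanSpace ℝ (EIdx n))
    (μ : EuclideanSpace ℝ (PIdx n)) (ν : ℝ) : ℝ :=
  (1 / 2) * ‖Ehat - EvecE μ ν‖ ^ 2



open Filter Topology

section Eigenvalues

variable {ι : Type*} [Fintype ι] [DecidableEq ι]

/-- `i` and `j` index the smallest and the second smallest value of `f`. -/
structure IsLowestPair (f : ι → ℝ) (i j : ι) : Prop where
  ne : i ≠ j
  le : f i ≤ f j
  le_of_ne : ∀ l, l ≠ i → f j ≤ f l

theorem exists_isLowestPair [Nontrivial ι] (f : ι → ℝ) : ∃ i j, IsLowestPair f i j := by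
  obtain ⟨i, -, hi⟩ := Finset.exists_min_image Finset.univ f Finset.univ_nonempty
  obtain ⟨l, hl⟩ := exists_ne i
  obtain ⟨j, hj, hj'⟩ := Finset.exists_min_image (Finset.univ.erase i) f
    ⟨l, Finset.mem_erase.2 ⟨hl, Finset.mem_univ l⟩⟩
  exact ⟨i, j, (Finset.ne_of_mem_erase hj).symm, hi j (Finset.mem_univ j),
    fun l hl => hj' l (Finset.mem_erase.2 ⟨hl, Finset.mem_univ l⟩)⟩

omit [Fintype ι] [DecidableEq ι] in
theorem IsLowestPair.const_mul {f : ι → ℝ} {i j : ι} (h : IsLowestPair f i j) {c : ℝ}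
    (hc : 0 ≤ c) : IsLowestPair (fun l => c * f l) i j :=
  ⟨h.ne, mul_le_mul_of_nonneg_left h.le hc,
    fun l hl => mul_le_mul_of_nonneg_left (h.le_of_ne l hl) hc⟩

theorem IsLowestPair.sort_eq {f : ι → ℝ} {i j : ι} (h : IsLowestPair f i j) :
    ∃ t, (Finset.univ.val.map f).sort (· ≤ ·) = f i :: f j :: t := by
  have hm : (Finset.univ : Finset ι).val = i ::ₘ j ::ₘ ((Finset.univ.erase i).erase j).val := by
    rw [← Finset.insert_val_of_notMem (by simp), ← Finset.insert_val_of_notMem (by simp [h.ne]),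
      Finset.insert_erase (by simp [h.ne.symm]), Finset.insert_erase (by simp)]
  rw [hm, Multiset.map_cons, Multiset.map_cons, Multiset.sort_cons, Multiset.sort_cons]
  · exact ⟨_, rfl⟩
  · intro b hb
    obtain ⟨l, hl, rfl⟩ := Multiset.mem_map.1 hb
    exact h.le_of_ne l (Finset.ne_of_mem_erase (Finset.mem_of_mem_erase hl))
  · intro b hb
    rw [← Multiset.map_cons] at hb
    obtain ⟨l, hl, rfl⟩ := Multiset.mem_map.1 hb
    by_cases hli : l = i
    · rw [hli]
    · exact h.le.trans (h.le_of_ne l hli)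

theorem IsLowestPair.kthSmallest_zero {f : ι → ℝ} {i j : ι} (h : IsLowestPair f i j) :
    kthSmallest f 0 = f i := by
  obtain ⟨t, ht⟩ := h.sort_eq
  simp [kthSmallest, ht]

theorem IsLowestPair.kthSmallest_one {f : ι → ℝ} {i j : ι} (h : IsLowestPair f i j) :
    kthSmallest f 1 = f j := by
  obtain ⟨t, ht⟩ := h.sort_eq
  simp [kthSmallest, ht]

theorem charpoly_conj_diagonal {U : Matrix ι ι ℂ} (hU : U ∈ unitaryGroup ι ℂ) (f : ι → ℝ) :
    (U * diagonal (fun i => (f i : ℂ)) * star U).charpoly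
      = ∏ i, (Polynomial.X - Polynomial.C (f i : ℂ)) := by
  rw [charpoly_mul_comm, ← mul_assoc, mem_unitaryGroup_iff'.1 hU, one_mul, charpoly_diagonal]

theorem kthSmallest_eigenvalues_eq {A U : Matrix ι ι ℂ} (hA : A.IsHermitian)
    (hU : U ∈ unitaryGroup ι ℂ) {f : ι → ℝ}
    (h : A = U * diagonal (fun i => (f i : ℂ)) * star U) (k : ℕ) :
    kthSmallest hA.eigenvalues k = kthSmallest f k := by
  have hr : A.charpoly.roots = Finset.univ.val.map (fun i => (f i : ℂ)) := by
    rw [h, charpoly_conj_diagonal hU, Polynomial.roots_prod _ _ (Finset.prod_ne_zero_iff.2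
      fun i _ => Polynomial.X_sub_C_ne_zero _)]
    simp
  have := congrArg (Multiset.map Complex.re) (hA.roots_charpoly_eq_eigenvalues.symm.trans hr)
  simp only [Multiset.map_map, Function.comp_def] at this
  unfold kthSmallest
  simpa using congrArg (fun s => (Multiset.sort s (· ≤ ·)).getD k 0) this

theorem sum_row_normSq {P : Matrix ι ι ℂ} (hP : P ∈ unitaryGroup ι ℂ) (l : ι) :
    ∑ i, Complex.normSq (P l i) = 1 := by
  have := congrArg (fun M : Matrix ι ι ℂ => (M l l).re) (mem_unitaryGroup_iff.1 hP)
  simpa [Matrix.mul_apply, Matrix.star_apply, Complex.mul_conj] using this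

theorem sum_col_normSq {P : Matrix ι ι ℂ} (hP : P ∈ unitaryGroup ι ℂ) (i : ι) :
    ∑ l, Complex.normSq (P l i) = 1 := by
  have := congrArg (fun M : Matrix ι ι ℂ => (M i i).re) (mem_unitaryGroup_iff'.1 hP)
  simpa [Matrix.mul_apply, Matrix.star_apply, mul_comm, Complex.mul_conj] using this

theorem conj_diagonal_apply_re (P : Matrix ι ι ℂ) (f : ι → ℝ) (i : ι) :
    ((star P * diagonal (fun l => (f l : ℂ)) * P) i i).re = ∑ l, f l * Complex.normSq (P l i) := by
  rw [Matrix.mul_apply, Complex.re_sum]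
  refine Finset.sum_congr rfl fun l _ => ?_
  simp [Matrix.mul_diagonal, Matrix.star_apply, Complex.normSq_apply]
  ring

theorem IsLowestPair.le_conj {f : ι → ℝ} {i j : ι} (h : IsLowestPair f i j) {P : Matrix ι ι ℂ}
    (hP : P ∈ unitaryGroup ι ℂ) (a : ι) :
    f i ≤ ((star P * diagonal (fun l => (f l : ℂ)) * P) a a).re := by
  rw [conj_diagonal_apply_re, ← mul_one (f i), ← sum_col_normSq hP a, Finset.mul_sum]
  refine Finset.sum_le_sum fun l _ => mul_le_mul_of_nonneg_right ?_ (Complex.normSq_nonneg _)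
  by_cases hli : l = i
  · rw [hli]
  · exact h.le.trans (h.le_of_ne l hli)

/-- Ky Fan's inequality for the two smallest eigenvalues. -/
theorem IsLowestPair.add_le_conj {f : ι → ℝ} {i j : ι} (h : IsLowestPair f i j)
    {P : Matrix ι ι ℂ} (hP : P ∈ unitaryGroup ι ℂ) {a b : ι} (hab : a ≠ b) :
    f i + f j ≤ ((star P * diagonal (fun l => (f l : ℂ)) * P) a a).re
      + ((star P * diagonal (fun l => (f l : ℂ)) * P) b b).re := by
  rw [conj_diagonal_apply_re, conj_diagonal_apply_re]
  set w : ι → ℝ := fun l => Complex.normSq (P l a) + Complex.normSq (P l b) with hw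
  have hw0 : ∀ l, 0 ≤ w l := fun l => add_nonneg (Complex.normSq_nonneg _) (Complex.normSq_nonneg _)
  have hw1 : w i ≤ 1 := by
    rw [← sum_row_normSq hP i, hw]
    simp only
    rw [← Finset.sum_pair (f := fun c => Complex.normSq (P i c)) hab]
    exact Finset.sum_le_sum_of_subset_of_nonneg (Finset.subset_univ _)
      fun _ _ _ => Complex.normSq_nonneg _
  have hw2 : ∑ l, w l = 2 := by
    rw [Finset.sum_add_distrib, sum_col_normSq hP, sum_col_normSq hP]; norm_num
  have key : (f i - f j) * w i ≤ ∑ l, (f l - f j) * w l := by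
    rw [← Finset.add_sum_erase _ _ (Finset.mem_univ i)]
    refine le_add_of_nonneg_right (Finset.sum_nonneg fun l hl => ?_)
    exact mul_nonneg (sub_nonneg.2 (h.le_of_ne l (Finset.ne_of_mem_erase hl))) (hw0 l)
  have e1 : ∑ l, (f l - f j) * w l = (∑ l, f l * w l) - f j * 2 := by
    simp only [sub_mul, Finset.sum_sub_distrib, ← Finset.mul_sum, hw2]
  have e2 : ∑ l, f l * w l = (∑ l, f l * Complex.normSq (P l a))
      + ∑ l, f l * Complex.normSq (P l b) := by
    simp only [hw, mul_add, Finset.sum_add_distrib]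
  nlinarith [h.le]

theorem conj_eq_conj_diagonal_eigenvalues {A : Matrix ι ι ℂ} (hA : A.IsHermitian)
    (W : Matrix ι ι ℂ) :
    star W * A * W = star (star (hA.eigenvectorUnitary : Matrix ι ι ℂ) * W)
      * diagonal (fun l => (hA.eigenvalues l : ℂ))
      * (star (hA.eigenvectorUnitary : Matrix ι ι ℂ) * W) := by
  have hs := hA.spectral_theorem
  rw [Unitary.conjStarAlgAut_apply] at hs
  conv_lhs => rw [hs]
  simp [mul_assoc, Function.comp_def]

/-- The smallest eigenvalue is at most any diagonal entry in any orthonormal basis. -/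
theorem kthSmallest_zero_le [Nontrivial ι] {A W : Matrix ι ι ℂ} (hA : A.IsHermitian)
    (hW : W ∈ unitaryGroup ι ℂ) (a : ι) :
    kthSmallest hA.eigenvalues 0 ≤ ((star W * A * W) a a).re := by
  obtain ⟨i, j, h⟩ := exists_isLowestPair hA.eigenvalues
  rw [h.kthSmallest_zero, conj_eq_conj_diagonal_eigenvalues hA]
  exact h.le_conj (mul_mem (Unitary.star_mem hA.eigenvectorUnitary.2) hW) a

theorem kthSmallest_zero_add_one_le [Nontrivial ι] {A W : Matrix ι ι ℂ} (hA : A.IsHermitian)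
    (hW : W ∈ unitaryGroup ι ℂ) {a b : ι} (hab : a ≠ b) :
    kthSmallest hA.eigenvalues 0 + kthSmallest hA.eigenvalues 1
      ≤ ((star W * A * W) a a).re + ((star W * A * W) b b).re := by
  obtain ⟨i, j, h⟩ := exists_isLowestPair hA.eigenvalues
  rw [h.kthSmallest_zero, h.kthSmallest_one, conj_eq_conj_diagonal_eigenvalues hA]
  exact h.add_le_conj (mul_mem (Unitary.star_mem hA.eigenvectorUnitary.2) hW) hab

theorem exists_kthSmallest_eq [Nontrivial ι] {A : Matrix ι ι ℂ} (hA : A.IsHermitian) :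
    ∃ W ∈ unitaryGroup ι ℂ, ∃ a b, a ≠ b ∧
      kthSmallest hA.eigenvalues 0 = ((star W * A * W) a a).re ∧
      kthSmallest hA.eigenvalues 1 = ((star W * A * W) b b).re := by
  obtain ⟨i, j, h⟩ := exists_isLowestPair hA.eigenvalues
  have hs := hA.conjStarAlgAut_star_eigenvectorUnitary
  rw [Unitary.conjStarAlgAut_apply] at hs
  refine ⟨hA.eigenvectorUnitary, hA.eigenvectorUnitary.2, i, j, h.ne, ?_, ?_⟩
  · rw [h.kthSmallest_zero]; simp at hs; simp [hs]
  · rw [h.kthSmallest_one]; simp at hs; simp [hs]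

theorem conj_apply_re_sub_le {A B W : Matrix ι ι ℂ} (hW : W ∈ unitaryGroup ι ℂ) (a : ι) :
    ((star W * A * W) a a).re ≤ ((star W * B * W) a a).re + ∑ x, ∑ y, ‖A x y - B x y‖ := by
  rw [← sub_le_iff_le_add', ← Complex.sub_re, ← Matrix.sub_apply, ← sub_mul, ← mul_sub]
  refine (Complex.re_le_norm _).trans ?_
  rw [Matrix.mul_apply, Finset.sum_comm]
  refine (norm_sum_le _ _).trans (Finset.sum_le_sum fun y _ => ?_)
  rw [norm_mul]
  refine (mul_le_of_le_one_right (norm_nonneg _) (entry_norm_bound_of_unitary hW y a)).trans ?_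
  rw [Matrix.mul_apply]
  refine (norm_sum_le _ _).trans (Finset.sum_le_sum fun x _ => ?_)
  rw [norm_mul]
  exact mul_le_of_le_one_left (norm_nonneg _)
    (entry_norm_bound_of_unitary (Unitary.star_mem hW) a x)

theorem kthSmallest_zero_le_add [Nontrivial ι] {A B : Matrix ι ι ℂ} (hA : A.IsHermitian)
    (hB : B.IsHermitian) :
    kthSmallest hA.eigenvalues 0
      ≤ kthSmallest hB.eigenvalues 0 + ∑ x, ∑ y, ‖A x y - B x y‖ := by
  obtain ⟨W, hW, a, b, -, h0, -⟩ := exists_kthSmallest_eq hB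
  rw [h0]
  exact (kthSmallest_zero_le hA hW a).trans (conj_apply_re_sub_le hW a)

theorem kthSmallest_zero_add_one_le_add [Nontrivial ι] {A B : Matrix ι ι ℂ} (hA : A.IsHermitian)
    (hB : B.IsHermitian) :
    kthSmallest hA.eigenvalues 0 + kthSmallest hA.eigenvalues 1
      ≤ kthSmallest hB.eigenvalues 0 + kthSmallest hB.eigenvalues 1
        + 2 * ∑ x, ∑ y, ‖A x y - B x y‖ := by
  obtain ⟨W, hW, a, b, hab, h0, h1⟩ := exists_kthSmallest_eq hB
  rw [h0, h1]
  linarith [kthSmallest_zero_add_one_le hA hW hab, conj_apply_re_sub_le (A := A) (B := B) hW a,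
    conj_apply_re_sub_le (A := A) (B := B) hW b]

end Eigenvalues

section Perturbation

variable {E : Type*} [NormedAddCommGroup E] [NormedSpace ℝ E]

theorem contDiffAt_of_continuousAt_of_root [CompleteSpace E] {F : E × ℝ → ℝ} {g : E → ℝ} {x₀ : E}
    {c : ℝ} (hF : ContDiffAt ℝ 1 F (x₀, g x₀)) (hg : ContinuousAt g x₀) (h0 : ∀ x, F (x, g x) = 0)
    (hd : HasDerivAt (fun t => F (x₀, t)) c (g x₀)) (hc : c ≠ 0) : ContDiffAt ℝ 1 g x₀ := by
  have hinr : HasFDerivAt (fun t : ℝ => F (x₀, t))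
      (fderiv ℝ F (x₀, g x₀) ∘L .inr ℝ E ℝ) (g x₀) :=
    (hF.differentiableAt one_ne_zero).hasFDerivAt.comp (g x₀) (hasFDerivAt_prodMk_right x₀ (g x₀))
  have hinv : (fderiv ℝ F (x₀, g x₀) ∘L .inr ℝ E ℝ).IsInvertible := by
    rw [hinr.unique hd.hasFDerivAt]
    refine ⟨ContinuousLinearEquiv.unitsEquivAut ℝ (Units.mk0 c hc), ?_⟩
    ext
    simp
  refine (hF.contDiffAt_implicitFunction one_ne_zero hinv).congr_of_eventuallyEq ?_
  have hev := hF.eventually_apply_eq_iff_implicitFunction one_ne_zero hinv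
  have ht : Tendsto (fun x => (x, g x)) (𝓝 x₀) (𝓝 (x₀, g x₀)) := continuousAt_id.prodMk hg
  filter_upwards [ht.eventually hev] with x hx
  exact (hx.1 (by rw [h0, h0])).symm

variable {ι : Type*} [Fintype ι] [DecidableEq ι]

theorem contDiff_det_smul_one_sub {H : E → Matrix ι ι ℂ}
    (hs : ∀ a b, ContDiff ℝ 1 (fun x => H x a b)) :
    ContDiff ℝ 1 (fun p : E × ℝ => ((Matrix.scalar ι (p.2 : ℂ) - H p.1).det).re) := by
  refine Complex.reCLM.contDiff.comp ?_
  simp only [Matrix.det_apply]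
  refine ContDiff.sum fun σ _ => ContDiff.const_smul _ (contDiff_prod fun i _ => ?_)
  simp only [Matrix.sub_apply, Matrix.scalar_apply, Matrix.diagonal_apply]
  refine ContDiff.sub ?_ ((hs _ _).comp contDiff_fst)
  split_ifs
  · exact Complex.ofRealCLM.contDiff.comp contDiff_snd
  · exact contDiff_const

omit [DecidableEq ι] in
theorem differentiable_conj_apply_re {H : E → Matrix ι ι ℂ}
    (hs : ∀ a b, ContDiff ℝ 1 (fun x => H x a b)) (U : Matrix ι ι ℂ) (a : ι) :
    Differentiable ℝ (fun x => ((star U * H x * U) a a).re) := by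
  have hd : ∀ a b, Differentiable ℝ (fun x => H x a b) :=
    fun a b => (hs a b).differentiable one_ne_zero
  refine Complex.reCLM.differentiable.comp ?_
  simp only [Matrix.mul_apply]
  fun_prop

variable [Nontrivial ι] {H : E → Matrix ι ι ℂ} (hH : ∀ x, (H x).IsHermitian)
  (hs : ∀ a b, ContDiff ℝ 1 (fun x => H x a b)) {x₀ : E}

include hs

omit [DecidableEq ι] [Nontrivial ι] in
theorem tendsto_sum_norm_sub : Tendsto (fun x => ∑ a, ∑ b, ‖H x a b - H x₀ a b‖) (𝓝 x₀) (𝓝 0) := by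
  have hc : ∀ a b, Continuous (fun x => H x a b) := fun a b => (hs a b).continuous
  have : Continuous (fun x => ∑ a, ∑ b, ‖H x a b - H x₀ a b‖) := by fun_prop
  simpa using this.tendsto x₀

theorem continuousAt_kthSmallest_zero :
    ContinuousAt (fun x => kthSmallest (hH x).eigenvalues 0) x₀ := by
  refine tendsto_iff_dist_tendsto_zero.2 (squeeze_zero (fun _ => dist_nonneg) (fun x => ?_)
    (tendsto_sum_norm_sub hs))
  have h1 := kthSmallest_zero_le_add (hH x) (hH x₀)
  have h2 := kthSmallest_zero_le_add (hH x₀) (hH x)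
  simp only [norm_sub_rev (H x₀ _ _)] at h2
  rw [Real.dist_eq, abs_le]
  constructor <;> linarith

theorem continuousAt_kthSmallest_one :
    ContinuousAt (fun x => kthSmallest (hH x).eigenvalues 1) x₀ := by
  have h : ContinuousAt (fun x => kthSmallest (hH x).eigenvalues 0
      + kthSmallest (hH x).eigenvalues 1) x₀ := by
    refine tendsto_iff_dist_tendsto_zero.2 (squeeze_zero (fun _ => dist_nonneg) (fun x => ?_)
      (by simpa using (tendsto_sum_norm_sub hs).const_mul 2))
    have h1 := kthSmallest_zero_add_one_le_add (hH x) (hH x₀)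
    have h2 := kthSmallest_zero_add_one_le_add (hH x₀) (hH x)
    simp only [norm_sub_rev (H x₀ _ _)] at h2
    rw [Real.dist_eq, abs_le]
    constructor <;> linarith
  simpa using h.fun_sub (continuousAt_kthSmallest_zero hH hs)

omit hs [Nontrivial ι] in
theorem det_scalar_sub_re_eq_zero {A : Matrix ι ι ℂ} (hA : A.IsHermitian) (i : ι) :
    ((Matrix.scalar ι (hA.eigenvalues i : ℂ) - A).det).re = 0 := by
  rw [← Matrix.eval_charpoly, hA.charpoly_eq, Polynomial.eval_prod,
    Finset.prod_eq_zero (Finset.mem_univ i) (by simp), Complex.zero_re]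

omit [Nontrivial ι] in
theorem contDiffAt_kthSmallest [CompleteSpace E] {k : ℕ} {f : ι → ℝ} {U : Matrix ι ι ℂ}
    (hU : U ∈ unitaryGroup ι ℂ) (hd : H x₀ = U * diagonal (fun i => (f i : ℂ)) * star U)
    (hc : ContinuousAt (fun x => kthSmallest (hH x).eigenvalues k) x₀)
    (hk : ∀ x, ∃ i, kthSmallest (hH x).eigenvalues k = (hH x).eigenvalues i)
    {i : ι} (hi : kthSmallest f k = f i) (hne : ∀ l, l ≠ i → f l ≠ f i) :
    ContDiffAt ℝ 1 (fun x => kthSmallest (hH x).eigenvalues k) x₀ := by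
  have hx₀ : kthSmallest (hH x₀).eigenvalues k = f i := by
    rw [kthSmallest_eigenvalues_eq (hH x₀) hU hd, hi]
  refine contDiffAt_of_continuousAt_of_root
    (F := fun p : E × ℝ => ((Matrix.scalar ι (p.2 : ℂ) - H p.1).det).re)
    (c := ∏ l ∈ Finset.univ.erase i, (f i - f l))
    (contDiff_det_smul_one_sub hs).contDiffAt hc (fun x => ?_) ?_ ?_
  · obtain ⟨i, hi⟩ := hk x
    simp only [hi]
    exact det_scalar_sub_re_eq_zero (hH x) i
  · have e : (fun t : ℝ => ((Matrix.scalar ι (t : ℂ) - H x₀).det).re)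
        = (fun t => t - f i) * (fun t => ∏ l ∈ Finset.univ.erase i, (t - f l)) := by
      ext t
      rw [← Matrix.eval_charpoly, hd, charpoly_conj_diagonal hU, Polynomial.eval_prod,
        Pi.mul_apply, Finset.mul_prod_erase Finset.univ (fun l => t - f l) (Finset.mem_univ i)]
      simp [← Complex.ofReal_sub, ← Complex.ofReal_prod]
    simp only [e, hx₀]
    have h2 : DifferentiableAt ℝ (fun t => ∏ l ∈ Finset.univ.erase i, (t - f l)) (f i) := by
      fun_prop
    simpa using ((hasDerivAt_id (f i)).sub_const (f i)).mul h2.hasDerivAt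
  · exact Finset.prod_ne_zero_iff.2 fun l hl =>
      sub_ne_zero.2 (hne l (Finset.ne_of_mem_erase hl)).symm

/-- If the two smallest eigenvalues are simple, the spectral gap is `C¹` and its derivative is given
by first order perturbation theory. -/
theorem contDiffAt_gap [CompleteSpace E] {f : ι → ℝ} {U : Matrix ι ι ℂ} (hU : U ∈ unitaryGroup ι ℂ)
    (hd : H x₀ = U * diagonal (fun i => (f i : ℂ)) * star U) {i j : ι} (hij : IsLowestPair f i j)
    (hi : ∀ l, l ≠ i → f l ≠ f i) (hj : ∀ l, l ≠ j → f l ≠ f j) :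
    ContDiffAt ℝ 1 (fun x => kthSmallest (hH x).eigenvalues 1
      - kthSmallest (hH x).eigenvalues 0) x₀ ∧
    fderiv ℝ (fun x => kthSmallest (hH x).eigenvalues 1 - kthSmallest (hH x).eigenvalues 0) x₀
      = fderiv ℝ (fun x => ((star U * H x * U) j j).re) x₀
        - fderiv ℝ (fun x => ((star U * H x * U) i i).re) x₀ := by
  have h0 : ContDiffAt ℝ 1 (fun x => kthSmallest (hH x).eigenvalues 0) x₀ := by
    refine contDiffAt_kthSmallest hH hs hU hd (continuousAt_kthSmallest_zero hH hs) (fun x => ?_)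
      hij.kthSmallest_zero hi
    obtain ⟨a, b, h⟩ := exists_isLowestPair (hH x).eigenvalues
    exact ⟨a, h.kthSmallest_zero⟩
  have h1 : ContDiffAt ℝ 1 (fun x => kthSmallest (hH x).eigenvalues 1) x₀ := by
    refine contDiffAt_kthSmallest hH hs hU hd (continuousAt_kthSmallest_one hH hs) (fun x => ?_)
      hij.kthSmallest_one hj
    obtain ⟨a, b, h⟩ := exists_isLowestPair (hH x).eigenvalues
    exact ⟨b, h.kthSmallest_one⟩
  refine ⟨h1.sub h0, ?_⟩
  have d0 := h0.differentiableAt one_ne_zero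
  have d1 := h1.differentiableAt one_ne_zero
  have q := differentiable_conj_apply_re hs U
  have hdiag : ∀ a, ((star U * H x₀ * U) a a).re = f a := by
    intro a
    have : star U * H x₀ * U = diagonal (fun i => (f i : ℂ)) := by
      rw [hd, show star U * (U * diagonal (fun i => (f i : ℂ)) * star U) * U
        = (star U * U) * diagonal (fun i => (f i : ℂ)) * (star U * U) by simp only [mul_assoc],
        mem_unitaryGroup_iff'.1 hU, one_mul, mul_one]
    simp [this]
  have k0 : kthSmallest (hH x₀).eigenvalues 0 = f i := by
    rw [kthSmallest_eigenvalues_eq (hH x₀) hU hd, hij.kthSmallest_zero]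
  have k1 : kthSmallest (hH x₀).eigenvalues 1 = f j := by
    rw [kthSmallest_eigenvalues_eq (hH x₀) hU hd, hij.kthSmallest_one]
  have m0 : IsLocalMax (fun x => kthSmallest (hH x).eigenvalues 0
      - ((star U * H x * U) i i).re) x₀ := by
    refine Eventually.of_forall fun x => ?_
    simp only [k0, hdiag]
    linarith [kthSmallest_zero_le (hH x) hU i]
  have m1 : IsLocalMax (fun x => kthSmallest (hH x).eigenvalues 0
      + kthSmallest (hH x).eigenvalues 1
      - (((star U * H x * U) i i).re + ((star U * H x * U) j j).re)) x₀ := by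
    refine Eventually.of_forall fun x => ?_
    simp only [k0, k1, hdiag]
    linarith [kthSmallest_zero_add_one_le (hH x) hU hij.ne]
  have e0 := m0.fderiv_eq_zero
  have e1 := m1.fderiv_eq_zero
  rw [fderiv_fun_sub d0 (q i x₀), sub_eq_zero] at e0
  rw [fderiv_fun_sub (d0.fun_add d1) ((q i x₀).fun_add (q j x₀)), fderiv_fun_add d0 d1,
    fderiv_fun_add (q i x₀) (q j x₀), e0, sub_eq_zero, add_right_inj] at e1
  rw [fderiv_fun_sub d1 d0, e0, e1]

end Perturbation

section Pauli

variable {n : ℕ}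

/-- The Kronecker product of a family of one-qubit matrices. -/
def tensor (M : Fin n → Matrix (Fin 2) (Fin 2) ℂ) : Matrix (Fin n → Fin 2) (Fin n → Fin 2) ℂ :=
  fun x y => ∏ j, M j (x j) (y j)

theorem pauliString_eq_tensor (a : Fin n → Fin 4) :
    pauliString a = tensor fun j => pauli (a j) := rfl

theorem tensor_mul (M N : Fin n → Matrix (Fin 2) (Fin 2) ℂ) :
    tensor M * tensor N = tensor fun j => M j * N j := by
  ext x y
  simp only [tensor, Matrix.mul_apply, Finset.prod_univ_sum, Fintype.piFinset_univ,
    Finset.prod_mul_distrib]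

theorem star_tensor (M : Fin n → Matrix (Fin 2) (Fin 2) ℂ) :
    star (tensor M) = tensor fun j => star (M j) := by
  ext x y
  simp [tensor, Matrix.star_apply]

theorem tensor_diagonal (d : Fin n → Fin 2 → ℂ) :
    tensor (fun j => diagonal (d j)) = diagonal fun x => ∏ j, d j (x j) := by
  ext x y
  by_cases h : x = y
  · simp [tensor, h]
  · obtain ⟨j, hj⟩ := Function.ne_iff.1 h
    rw [diagonal_apply_ne _ h]
    exact Finset.prod_eq_zero (Finset.mem_univ j) (diagonal_apply_ne _ hj)

theorem tensor_one : tensor (fun _ : Fin n => (1 : Matrix (Fin 2) (Fin 2) ℂ)) = 1 := by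
  have := tensor_diagonal (fun (_ : Fin n) (_ : Fin 2) => (1 : ℂ))
  simpa using this

theorem pauli_isHermitian (a : Fin 4) : (pauli a).IsHermitian := by
  fin_cases a <;> ext i j <;> fin_cases i <;> fin_cases j <;> simp [pauli]

theorem pauliString_isHermitian (a : Fin n → Fin 4) : (pauliString a).IsHermitian := by
  rw [pauliString_eq_tensor, Matrix.IsHermitian, ← Matrix.star_eq_conjTranspose, star_tensor]
  exact congrArg tensor (funext fun j => pauli_isHermitian (a j))

/-- The columns of `pauliBasis b` are orthonormal eigenvectors of the Pauli matrix `b.succ`. -/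
noncomputable def pauliBasis : Fin 3 → Matrix (Fin 2) (Fin 2) ℂ
  | 0 => ((1 + Complex.I) / 2) • !![1, 1; 1, -1]
  | 1 => ((1 + Complex.I) / 2) • !![1, 1; Complex.I, -Complex.I]
  | 2 => 1

/-- The diagonal entries of the Pauli matrix `a` in the eigenbasis of the Pauli matrix `b.succ`. -/
noncomputable def pauliCoef (a : Fin 4) (b : Fin 3) (t : Fin 2) : ℝ :=
  if a = 0 then 1 else if a = b.succ then (-1) ^ (t : ℕ) else 0

theorem star_pauliBasis_mul_self (b : Fin 3) : star (pauliBasis b) * pauliBasis b = 1 := by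
  fin_cases b <;> ext i j <;> fin_cases i <;> fin_cases j <;>
    simp [pauliBasis, Matrix.mul_apply, Fin.sum_univ_two, Matrix.star_apply] <;>
    simp [Complex.ext_iff, map_ofNat] <;> norm_num

theorem pauliBasis_conj_self (b : Fin 3) : star (pauliBasis b) * pauli b.succ * pauliBasis b
    = diagonal fun t => (pauliCoef b.succ b t : ℂ) := by
  fin_cases b <;> ext i j <;> fin_cases i <;> fin_cases j <;>
    simp [pauliBasis, pauli, pauliCoef, Matrix.mul_apply, Fin.sum_univ_two, Matrix.star_apply] <;>
    simp [Complex.ext_iff, map_ofNat] <;> norm_num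

theorem pauliBasis_conj_zero (b : Fin 3) : star (pauliBasis b) * pauli 0 * pauliBasis b
    = diagonal fun t => (pauliCoef 0 b t : ℂ) := by
  simp [pauli, star_pauliBasis_mul_self, pauliCoef]

theorem pauliBasis_conj_apply (a : Fin 4) (b : Fin 3) (t : Fin 2) :
    (star (pauliBasis b) * pauli a * pauliBasis b) t t = pauliCoef a b t := by
  by_cases h0 : a = 0
  · rw [h0, pauliBasis_conj_zero, diagonal_apply_eq]
  by_cases h1 : a = b.succ
  · rw [h1, pauliBasis_conj_self, diagonal_apply_eq]
  have : pauliCoef a b t = 0 := by simp [pauliCoef, h0, h1]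
  rw [this]
  fin_cases a <;> fin_cases b <;> simp at h0 h1 <;> fin_cases t <;>
    simp [pauliBasis, pauli, Matrix.mul_apply, Fin.sum_univ_two, Matrix.star_apply] <;> ring_nf <;>
    simp [map_ofNat] <;> norm_num

/-- The basis of joint eigenvectors of the one-qubit Pauli matrices chosen by `β`. -/
noncomputable def productBasis (β : Fin n → Fin 3) : Matrix (Fin n → Fin 2) (Fin n → Fin 2) ℂ :=
  tensor fun j => pauliBasis (β j)

theorem productBasis_mem_unitaryGroup (β : Fin n → Fin 3) :
    productBasis β ∈ unitaryGroup (Fin n → Fin 2) ℂ := by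
  rw [mem_unitaryGroup_iff', productBasis, star_tensor, tensor_mul]
  simp only [star_pauliBasis_mul_self, tensor_one]

/-- The expectation of a Pauli string in a vector of the product basis. -/
noncomputable def stringCoef (a : Fin n → Fin 4) (β : Fin n → Fin 3) (t : Fin n → Fin 2) : ℝ :=
  ∏ j, pauliCoef (a j) (β j) (t j)

theorem productBasis_conj_pauliString (a : Fin n → Fin 4) (β : Fin n → Fin 3) :
    star (productBasis β) * pauliString a * productBasis β
      = tensor fun j => star (pauliBasis (β j)) * pauli (a j) * pauliBasis (β j) := by
  rw [productBasis, star_tensor, pauliString_eq_tensor, tensor_mul, tensor_mul]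

theorem productBasis_conj_pauliString_apply (a : Fin n → Fin 4) (β : Fin n → Fin 3)
    (t : Fin n → Fin 2) :
    (star (productBasis β) * pauliString a * productBasis β) t t = stringCoef a β t := by
  rw [productBasis_conj_pauliString]
  simp only [tensor, pauliBasis_conj_apply, stringCoef, Complex.ofReal_prod]

theorem productBasis_conj_pauliAt (j : Fin n) (β : Fin n → Fin 3) :
    star (productBasis β) * pauliAt j (β j) * productBasis β
      = diagonal fun t => (-1 : ℂ) ^ (t j : ℕ) := by
  rw [pauliAt, productBasis_conj_pauliString]
  have : (fun i => star (pauliBasis (β i)) * pauli (if i = j then (β j).succ else 0)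
      * pauliBasis (β i)) = fun i => diagonal fun t : Fin 2 =>
        if i = j then (-1 : ℂ) ^ (t : ℕ) else 1 := by
    funext i
    split_ifs with h
    · rw [h, pauliBasis_conj_self]; simp [pauliCoef]
    · rw [pauliBasis_conj_zero]; simp [pauliCoef]
  rw [this, tensor_diagonal]
  simp

/-- The eigenvalues of `-Hctrl k s β`. -/
noncomputable def ctrlEnergy (k : Fin n) (s t : Fin n → Fin 2) : ℝ :=
  -∑ j, (if j = k then 1 / 2 else 1) * ((-1) ^ (s j : ℕ) * (-1) ^ (t j : ℕ))

theorem productBasis_conj_Hctrl (k : Fin n) (s : Fin n → Fin 2) (β : Fin n → Fin 3) :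
    star (productBasis β) * Hctrl k s β * productBasis β
      = diagonal fun t => -(ctrlEnergy k s t : ℂ) := by
  rw [Hctrl, mul_add, add_mul, Finset.mul_sum, Finset.sum_mul]
  simp only [Matrix.mul_smul, Matrix.smul_mul, productBasis_conj_pauliAt]
  ext x y
  by_cases h : x = y
  · subst h
    simp only [Matrix.add_apply, Matrix.sum_apply, Matrix.smul_apply, diagonal_apply_eq, ctrlEnergy,
      ← Finset.add_sum_erase _ _ (Finset.mem_univ k), smul_eq_mul]
    push_cast
    rw [neg_neg, add_comm]
    congr 1
    · ring
    · refine Finset.sum_congr rfl fun j hj => ?_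
      simp [Finset.ne_of_mem_erase hj]
  · simp [Matrix.sum_apply, h]

theorem neg_Hctrl_eq (k : Fin n) (s : Fin n → Fin 2) (β : Fin n → Fin 3) :
    -Hctrl k s β = productBasis β * diagonal (fun t => (ctrlEnergy k s t : ℂ))
      * star (productBasis β) := by
  have h := mem_unitaryGroup_iff.1 (productBasis_mem_unitaryGroup β)
  have e : (diagonal fun t => (ctrlEnergy k s t : ℂ))
      = -(star (productBasis β) * Hctrl k s β * productBasis β) := by
    rw [productBasis_conj_Hctrl]; ext x y; by_cases hxy : x = y <;> simp [hxy]
  rw [e, mul_neg, neg_mul, show productBasis β * (star (productBasis β) * Hctrl k s β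
    * productBasis β) * star (productBasis β) = (productBasis β * star (productBasis β))
    * Hctrl k s β * (productBasis β * star (productBasis β)) by simp only [mul_assoc], h, one_mul,
    mul_one]

theorem ctrlEnergy_eq (k : Fin n) (s t : Fin n → Fin 2) :
    ctrlEnergy k s t = ctrlEnergy k s s
      + ∑ j, if t j = s j then 0 else if j = k then (1 : ℝ) else 2 := by
  rw [ctrlEnergy, ctrlEnergy, ← Finset.sum_neg_distrib, ← Finset.sum_neg_distrib,
    ← Finset.sum_add_distrib]
  refine Finset.sum_congr rfl fun j _ => ?_
  generalize s j = a
  generalize t j = b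
  fin_cases a <;> fin_cases b <;> split_ifs <;> simp_all <;> norm_num

/-- Flip the `k`-th bit. -/
def flipBit (k : Fin n) (s : Fin n → Fin 2) : Fin n → Fin 2 := Function.update s k (s k + 1)

theorem ctrlEnergy_flipBit (k : Fin n) (s : Fin n → Fin 2) :
    ctrlEnergy k s (flipBit k s) = ctrlEnergy k s s + 1 := by
  rw [ctrlEnergy_eq, Finset.sum_eq_single k]
  · simp [flipBit]
  · intro j _ hj; simp [flipBit, hj]
  · simp

theorem le_ctrlEnergy {k : Fin n} {s t : Fin n → Fin 2} {j : Fin n} (hj : t j ≠ s j) :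
    ctrlEnergy k s s + (if j = k then 1 else 2) ≤ ctrlEnergy k s t := by
  rw [ctrlEnergy_eq k s t]
  refine (add_le_add_iff_left _).2 ?_
  have := Finset.single_le_sum (s := Finset.univ)
    (f := fun j => if t j = s j then 0 else if j = k then (1 : ℝ) else 2)
    (fun i _ => by split_ifs <;> norm_num) (Finset.mem_univ j)
  simpa [hj] using this

theorem ctrlEnergy_add_one_le {k : Fin n} {s t : Fin n → Fin 2} (h : t ≠ s) :
    ctrlEnergy k s s + 1 ≤ ctrlEnergy k s t := by
  obtain ⟨j, hj⟩ := Function.ne_iff.1 h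
  refine le_trans ?_ (le_ctrlEnergy hj)
  split_ifs <;> norm_num

theorem ctrlEnergy_add_two_le {k : Fin n} {s t : Fin n → Fin 2} (h : t ≠ s)
    (h' : t ≠ flipBit k s) : ctrlEnergy k s s + 2 ≤ ctrlEnergy k s t := by
  obtain ⟨j, hjk, hj⟩ : ∃ j, j ≠ k ∧ t j ≠ s j := by
    by_contra! hc
    have hk : t k ≠ s k := fun hk => h (funext fun j => by
      by_cases hj : j = k
      · rw [hj, hk]
      · exact hc j hj)
    refine h' (funext fun j => ?_)
    by_cases hj : j = k
    · subst hj; simp only [flipBit, Function.update_self]; omega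
    · simp [flipBit, hj, hc j hj]
  simpa [hjk] using le_ctrlEnergy (k := k) hj

theorem isLowestPair_ctrlEnergy (k : Fin n) (s : Fin n → Fin 2) :
    IsLowestPair (ctrlEnergy k s) s (flipBit k s) where
  ne h := by simpa [flipBit] using congrFun h k
  le := by rw [ctrlEnergy_flipBit]; linarith
  le_of_ne l hl := by rw [ctrlEnergy_flipBit]; exact ctrlEnergy_add_one_le hl

end Pauli

section Gap

variable {n : ℕ}

theorem Htot_isHermitian (lam : PIdx n → ℝ) (ν : ℝ) (k : Fin n) (s : Fin n → Fin 2)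
    (β : Fin n → Fin 3) : (Htot lam ν k s β).IsHermitian := by
  have hp : ∀ a : Fin n → Fin 4, (pauliString a)ᴴ = pauliString a := pauliString_isHermitian
  have hp' : ∀ j b, (pauliAt j b : Matrix (Fin n → Fin 2) (Fin n → Fin 2) ℂ)ᴴ = pauliAt j b :=
    fun j b => pauliString_isHermitian _
  simp [Matrix.IsHermitian, Htot, Hmat, Hctrl, Matrix.conjTranspose_sum, hp, hp']

theorem Egap_eq (lam : PIdx n → ℝ) (ν : ℝ) (k : Fin n) (s : Fin n → Fin 2) (β : Fin n → Fin 3) :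
    Egap lam ν k s β = kthSmallest (Htot_isHermitian lam ν k s β).eigenvalues 1
      - kthSmallest (Htot_isHermitian lam ν k s β).eigenvalues 0 :=
  dif_pos (Htot_isHermitian lam ν k s β)

theorem kthSmallest_eigenvalues_smul {ι : Type*} [Fintype ι] [DecidableEq ι] {A B : Matrix ι ι ℂ}
    (hA : A.IsHermitian) (hB : B.IsHermitian) {c : ℝ} (h : A = (c : ℂ) • B) (k : ℕ) :
    kthSmallest hA.eigenvalues k = kthSmallest (fun i => c * hB.eigenvalues i) k := by
  refine kthSmallest_eigenvalues_eq hA hB.eigenvectorUnitary.2 ?_ k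
  have hs := hB.spectral_theorem
  rw [Unitary.conjStarAlgAut_apply] at hs
  have e : diagonal (fun i => ((c * hB.eigenvalues i : ℝ) : ℂ))
      = (c : ℂ) • diagonal (RCLike.ofReal ∘ hB.eigenvalues) := by
    ext x y
    by_cases hxy : x = y <;> simp [hxy]
  rw [e, Matrix.mul_smul, Matrix.smul_mul, ← hs, h]

theorem Egap_eq_mul (lam : PIdx n → ℝ) {ν : ℝ} (hν : 0 < ν) (k : Fin n) (s : Fin n → Fin 2)
    (β : Fin n → Fin 3) : Egap lam ν k s β = ν * Egap (ν⁻¹ • lam) 1 k s β := by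
  have : Nonempty (Fin n) := ⟨k⟩
  have h : Htot lam ν k s β = (ν : ℂ) • Htot (ν⁻¹ • lam) 1 k s β := by
    have hν' : (ν : ℂ) ≠ 0 := by exact_mod_cast hν.ne'
    simp only [Htot, Hmat, smul_sub, Finset.smul_sum, smul_smul, Pi.smul_apply, smul_eq_mul]
    simp [hν']
  have hB := Htot_isHermitian (ν⁻¹ • lam) 1 k s β
  obtain ⟨i, j, hij⟩ := exists_isLowestPair hB.eigenvalues
  rw [Egap_eq, Egap_eq, kthSmallest_eigenvalues_smul _ hB h, kthSmallest_eigenvalues_smul _ hB h,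
    (hij.const_mul hν.le).kthSmallest_zero, (hij.const_mul hν.le).kthSmallest_one,
    hij.kthSmallest_zero, hij.kthSmallest_one]
  ring

theorem EvecE_eq_smul (μ : EuclideanSpace ℝ (PIdx n)) {ν : ℝ} (hν : 0 < ν) :
    EvecE μ ν = ν • EvecE (ν⁻¹ • μ) 1 := by
  ext p
  exact Egap_eq_mul _ hν _ _ _

theorem hasFDerivAt_conj_Htot (k : Fin n) (s t : Fin n → Fin 2) (β : Fin n → Fin 3)
    (x : EuclideanSpace ℝ (PIdx n)) :
    HasFDerivAt (fun y : EuclideanSpace ℝ (PIdx n) =>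
        ((star (productBasis β) * Htot y 1 k s β * productBasis β) t t).re)
      (∑ a : PIdx n, stringCoef a.1 β t • (EuclideanSpace.proj a : _ →L[ℝ] ℝ)) x := by
  have e : (fun y : EuclideanSpace ℝ (PIdx n) =>
      ((star (productBasis β) * Htot y 1 k s β * productBasis β) t t).re)
      = fun y => (∑ a : PIdx n, stringCoef a.1 β t • (EuclideanSpace.proj a : _ →L[ℝ] ℝ)) y
        + ctrlEnergy k s t := by
    ext y
    simp only [Htot, Hmat, mul_sub, sub_mul, Matrix.mul_smul, Matrix.smul_mul, Finset.mul_sum,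
      Finset.sum_mul, productBasis_conj_Hctrl, Matrix.sub_apply, Matrix.sum_apply,
      Matrix.smul_apply, productBasis_conj_pauliString_apply]
    simp [mul_comm]
  rw [e]
  exact (ContinuousLinearMap.hasFDerivAt _).add_const _

theorem contDiff_Htot_apply (k : Fin n) (s : Fin n → Fin 2) (β : Fin n → Fin 3)
    (x y : Fin n → Fin 2) :
    ContDiff ℝ 1 (fun μ : EuclideanSpace ℝ (PIdx n) => Htot μ 1 k s β x y) := by
  simp only [Htot, Hmat, Matrix.sub_apply, Matrix.sum_apply, Matrix.smul_apply, smul_eq_mul]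
  refine ContDiff.sub (ContDiff.sum fun a _ => ContDiff.mul ?_ contDiff_const) contDiff_const
  exact Complex.ofRealCLM.contDiff.comp (EuclideanSpace.proj a : _ →L[ℝ] ℝ).contDiff

theorem contDiffAt_Egap (k : Fin n) (s : Fin n → Fin 2) (β : Fin n → Fin 3) :
    ContDiffAt ℝ 1 (fun μ : EuclideanSpace ℝ (PIdx n) => Egap μ 1 k s β) 0 ∧
    ∀ v, fderiv ℝ (fun μ : EuclideanSpace ℝ (PIdx n) => Egap μ 1 k s β) 0 v
      = ∑ a : PIdx n, v a * (stringCoef a.1 β (flipBit k s) - stringCoef a.1 β s) := by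
  have : Nonempty (Fin n) := ⟨k⟩
  have h0 : Htot ((0 : EuclideanSpace ℝ (PIdx n)) : PIdx n → ℝ) 1 k s β = productBasis β
      * diagonal (fun t => (ctrlEnergy k s t : ℂ)) * star (productBasis β) := by
    rw [← neg_Hctrl_eq]
    simp [Htot, Hmat]
  obtain ⟨h1, h2⟩ := contDiffAt_gap
    (H := fun μ : EuclideanSpace ℝ (PIdx n) => Htot μ 1 k s β)
    (fun μ => Htot_isHermitian μ 1 k s β) (contDiff_Htot_apply k s β)
    (productBasis_mem_unitaryGroup β) h0 (isLowestPair_ctrlEnergy k s)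
    (fun t ht => by linarith [ctrlEnergy_add_one_le (k := k) ht])
    (fun t ht => by
      rw [ctrlEnergy_flipBit]
      by_cases hts : t = s
      · rw [hts]; linarith
      · linarith [ctrlEnergy_add_two_le hts ht])
  simp only [Egap_eq]
  refine ⟨h1, fun v => ?_⟩
  rw [h2, (hasFDerivAt_conj_Htot k s _ β 0).fderiv, (hasFDerivAt_conj_Htot k s _ β 0).fderiv]
  simp [sub_mul, mul_comm]

theorem contDiffAt_EvecE :
    ContDiffAt ℝ 1 (fun μ : EuclideanSpace ℝ (PIdx n) => EvecE μ 1) 0 :=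
  contDiffAt_euclidean.2 fun p => (contDiffAt_Egap p.1 p.2.1 p.2.2).1

theorem fderiv_EvecE_apply (v : EuclideanSpace ℝ (PIdx n)) (p : EIdx n) :
    fderiv ℝ (fun μ : EuclideanSpace ℝ (PIdx n) => EvecE μ 1) 0 v p
      = ∑ a : PIdx n, v a * (stringCoef a.1 p.2.2 (flipBit p.1 p.2.1)
        - stringCoef a.1 p.2.2 p.2.1) := by
  rw [← (contDiffAt_Egap p.1 p.2.1 p.2.2).2 v]
  have h := (EuclideanSpace.proj p : EuclideanSpace ℝ (EIdx n) →L[ℝ] ℝ).hasFDerivAt.comp 0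
    (contDiffAt_EvecE.differentiableAt one_ne_zero).hasFDerivAt
  exact (DFunLike.congr_fun h.fderiv v).symm

end Gap

section Orthogonality

variable {n : ℕ}

theorem sum_pauliCoef_mul (a a' : Fin 4) (b : Fin 3) :
    ∑ t, pauliCoef a b t * pauliCoef a' b t
      = if a = a' ∧ (a = 0 ∨ a = b.succ) then 2 else 0 := by
  rw [Fin.sum_univ_two]
  have := Fin.succ_ne_zero b
  by_cases h : a = a'
  · subst h
    by_cases h0 : a = 0
    · simp [pauliCoef, h0]; norm_num
    · by_cases h1 : a = b.succ
      · simp [pauliCoef, h1]; norm_num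
      · simp [pauliCoef, h0, h1]
  · by_cases h0 : a = 0 <;> by_cases h1 : a = b.succ <;> by_cases h0' : a' = 0 <;>
      by_cases h1' : a' = b.succ <;> simp_all [pauliCoef]

theorem sum_stringCoef_mul (a a' : Fin n → Fin 4) (β : Fin n → Fin 3) :
    ∑ s, stringCoef a β s * stringCoef a' β s
      = if a = a' then (if ∀ j, a j = 0 ∨ a j = (β j).succ then 2 ^ n else 0) else 0 := by
  have h : ∑ s, stringCoef a β s * stringCoef a' β s
      = ∏ j, ∑ t, pauliCoef (a j) (β j) t * pauliCoef (a' j) (β j) t := by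
    simp only [stringCoef, Finset.prod_univ_sum, Fintype.piFinset_univ, Finset.prod_mul_distrib]
  simp only [h, sum_pauliCoef_mul]
  by_cases h' : a = a' ∧ ∀ j, a j = 0 ∨ a j = (β j).succ
  · obtain ⟨rfl, h'⟩ := h'
    simp [h']
  · obtain ⟨j, hj⟩ : ∃ j, ¬(a j = a' j ∧ (a j = 0 ∨ a j = (β j).succ)) := by
      by_contra! hc
      exact h' ⟨funext fun j => (hc j).1, fun j => (hc j).2⟩
    rw [Finset.prod_eq_zero (Finset.mem_univ j) (if_neg hj), ← ite_and, if_neg h']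

theorem stringCoef_flipBit_sub (a : Fin n → Fin 4) (β : Fin n → Fin 3) (k : Fin n)
    (s : Fin n → Fin 2) : stringCoef a β (flipBit k s) - stringCoef a β s
      = (if a k = 0 then 0 else -2) * stringCoef a β s := by
  have he : ∏ j ∈ Finset.univ.erase k, pauliCoef (a j) (β j) (flipBit k s j)
      = ∏ j ∈ Finset.univ.erase k, pauliCoef (a j) (β j) (s j) :=
    Finset.prod_congr rfl fun j hj => by simp [flipBit, Finset.ne_of_mem_erase hj]
  have hk : pauliCoef (a k) (β k) (s k + 1)
      = if a k = 0 then 1 else -pauliCoef (a k) (β k) (s k) := by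
    unfold pauliCoef
    generalize s k = t
    fin_cases t <;> split_ifs <;> simp
  rw [stringCoef, stringCoef, ← Finset.mul_prod_erase _ _ (Finset.mem_univ k),
    ← Finset.mul_prod_erase Finset.univ (fun j => pauliCoef (a j) (β j) (s j)) (Finset.mem_univ k),
    he, show flipBit k s k = s k + 1 by simp [flipBit], hk]
  split_ifs with h
  · simp [pauliCoef, h]
  · ring

theorem sum_sq_sum_stringCoef (w : PIdx n → ℝ) (β : Fin n → Fin 3) :
    ∑ s, (∑ a : PIdx n, w a * stringCoef a.1 β s) ^ 2
      = ∑ a : PIdx n, w a ^ 2 * (if ∀ j, a.1 j = 0 ∨ a.1 j = (β j).succ then 2 ^ n else 0) := by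
  simp only [pow_two (∑ a : PIdx n, w a * _), Finset.sum_mul_sum]
  rw [Finset.sum_comm]
  refine Finset.sum_congr rfl fun a _ => ?_
  rw [Finset.sum_comm]
  have : ∀ b : PIdx n, ∑ s, w a * stringCoef a.1 β s * (w b * stringCoef b.1 β s)
      = w a * w b * ∑ s, stringCoef a.1 β s * stringCoef b.1 β s := by
    intro b
    rw [Finset.mul_sum]
    exact Finset.sum_congr rfl fun s _ => by ring
  simp only [this, sum_stringCoef_mul, ← Subtype.ext_iff]
  simp [pow_two]

theorem norm_sq_le_norm_sq_fderiv_EvecE (v : EuclideanSpace ℝ (PIdx n)) :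
    4 * 2 ^ n * ‖v‖ ^ 2
      ≤ ‖fderiv ℝ (fun μ : EuclideanSpace ℝ (PIdx n) => EvecE μ 1) 0 v‖ ^ 2 := by
  rw [EuclideanSpace.real_norm_sq_eq, EuclideanSpace.real_norm_sq_eq]
  simp only [fderiv_EvecE_apply, stringCoef_flipBit_sub, ← mul_assoc]
  rw [Fintype.sum_prod_type]
  simp only [Fintype.sum_prod_type_right]
  simp only [sum_sq_sum_stringCoef (fun a => v a * if a.1 _ = 0 then 0 else -2)]
  rw [Finset.mul_sum]
  simp only [Finset.sum_comm (t := (Finset.univ : Finset (PIdx n)))]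
  refine Finset.sum_le_sum fun a _ => ?_
  obtain ⟨k, hk⟩ := Function.ne_iff.1 a.2
  have hβ : ∃ β : Fin n → Fin 3, ∀ j, a.1 j = 0 ∨ a.1 j = (β j).succ := by
    have : ∀ c : Fin 4, ∃ b : Fin 3, c = 0 ∨ c = b.succ := by decide
    choose b hb using this
    exact ⟨fun j => b (a.1 j), fun j => hb _⟩
  obtain ⟨β, hβ⟩ := hβ
  have hnn : ∀ k β, 0 ≤ (v a * if a.1 k = 0 then 0 else -2) ^ 2
      * (if ∀ j, a.1 j = 0 ∨ a.1 j = ((β : Fin n → Fin 3) j).succ then (2 : ℝ) ^ n else 0) := by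
    intro k β
    refine mul_nonneg (sq_nonneg _) ?_
    split_ifs <;> positivity
  refine le_trans (le_of_eq ?_) ((Finset.single_le_sum (fun β _ => hnn k β)
    (Finset.mem_univ β)).trans (Finset.single_le_sum (f := fun k => ∑ β : Fin n → Fin 3,
      (v a * if a.1 k = 0 then 0 else -2) ^ 2
      * (if ∀ j, a.1 j = 0 ∨ a.1 j = (β j).succ then (2 : ℝ) ^ n else 0))
    (fun k _ => Finset.sum_nonneg fun β _ => hnn k β) (Finset.mem_univ k)))
  rw [if_pos hβ, if_neg hk]
  ring

theorem norm_le_norm_fderiv_EvecE (v : EuclideanSpace ℝ (PIdx n)) :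
    2 * (2 : ℝ) ^ ((n : ℝ) / 2) * ‖v‖
      ≤ ‖fderiv ℝ (fun μ : EuclideanSpace ℝ (PIdx n) => EvecE μ 1) 0 v‖ := by
  refine le_of_sq_le_sq ?_ (norm_nonneg _)
  refine le_trans (le_of_eq ?_) (norm_sq_le_norm_sq_fderiv_EvecE v)
  have : ((2 : ℝ) ^ ((n : ℝ) / 2)) ^ 2 = 2 ^ n := by
    rw [← Real.rpow_natCast, ← Real.rpow_mul zero_le_two, ← Real.rpow_natCast]
    congr 1
    push_cast
    ring
  rw [mul_pow, mul_pow, this]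
  norm_num

end Orthogonality

/-- Well-conditioned Jacobian: for each `n ≥ 1` there are `ν₀, C_n > 0`
(depending only on `n`) such that for `ν ≥ ν₀` and `|μ_a| ≤ 1`, the map `μ' ↦ E(μ', ν)` is
differentiable at `μ` and its Jacobian `J(μ,ν)` satisfies
`‖J(μ,ν)v‖ ≥ (2^{n/2} − C_n/ν)‖v‖` for every `v`. -/
theorem stmt_14 (n : ℕ) (hn : 1 ≤ n) :
    ∃ ν₀ > (0 : ℝ), ∃ Cn > (0 : ℝ),
      ∀ ν : ℝ, ν₀ ≤ ν →
      ∀ μ : EuclideanSpace ℝ (PIdx n), (∀ a, |μ a| ≤ 1) →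
        DifferentiableAt ℝ (fun μ' => EvecE μ' ν) μ ∧
        ∀ v : EuclideanSpace ℝ (PIdx n),
          ((2 : ℝ) ^ ((n : ℝ) / 2) - Cn / ν) * ‖v‖ ≤
            ‖fderiv ℝ (fun μ' => EvecE μ' ν) μ v‖ := by
  set G : EuclideanSpace ℝ (PIdx n) → EuclideanSpace ℝ (EIdx n) := fun μ => EvecE μ 1 with hG
  have hGc : ContDiffAt ℝ 1 G 0 := contDiffAt_EvecE
  set c : ℝ := (2 : ℝ) ^ ((n : ℝ) / 2) with hc
  have hc0 : 0 < c := by positivity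
  have hcont : ContinuousAt (fderiv ℝ G) 0 :=
    (hGc.fderiv_right (m := 0) (by norm_num)).continuousAt
  have hev := ((hGc.eventually (by simp)).and
    (Metric.tendsto_nhds.1 hcont.tendsto c hc0))
  obtain ⟨δ, hδ, hball⟩ := Metric.eventually_nhds_iff.1 hev
  set R : ℝ := √(Fintype.card (PIdx n)) with hR
  refine ⟨(R + 1) / δ, by positivity, 1, one_pos, fun ν hν μ hμ => ?_⟩
  have hν0 : 0 < ν := lt_of_lt_of_le (by positivity) hν
  have hμR : ‖μ‖ ≤ R := by
    rw [EuclideanSpace.norm_eq, hR]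
    refine Real.sqrt_le_sqrt ?_
    refine (Finset.sum_le_sum fun a _ => (sq_le_one_iff₀ (norm_nonneg _)).2 (hμ a)).trans ?_
    simp
  have hd : dist (ν⁻¹ • μ) 0 < δ := by
    rw [dist_zero_right, norm_smul, Real.norm_of_nonneg (inv_nonneg.2 hν0.le),
      inv_mul_lt_iff₀ hν0]
    have := (div_le_iff₀ hδ).1 hν
    linarith
  obtain ⟨h1, h2⟩ := hball hd
  have hder : HasFDerivAt (fun μ' => EvecE μ' ν) (fderiv ℝ G (ν⁻¹ • μ)) μ := by
    have h3 := ((h1.differentiableAt one_ne_zero).hasFDerivAt.comp μ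
      ((hasFDerivAt_id μ).const_smul ν⁻¹)).const_smul ν
    have e : (fun μ' => EvecE μ' ν) = fun μ' => ν • G (ν⁻¹ • μ') :=
      funext fun μ' => EvecE_eq_smul μ' hν0
    rw [e]
    convert! h3 using 1
    ext v p
    simp [hν0.ne']
  refine ⟨hder.differentiableAt, fun v => ?_⟩
  rw [hder.fderiv]
  have h4 : 2 * c * ‖v‖ ≤ ‖fderiv ℝ G 0 v‖ := norm_le_norm_fderiv_EvecE v
  have h5 : ‖fderiv ℝ G 0 v‖ ≤ ‖fderiv ℝ G (ν⁻¹ • μ) v‖ + c * ‖v‖ := by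
    rw [dist_eq_norm] at h2
    have h6 := ((fderiv ℝ G (ν⁻¹ • μ) - fderiv ℝ G 0).le_opNorm v).trans
      (mul_le_mul_of_nonneg_right h2.le (norm_nonneg v))
    rw [_root_.sub_apply, norm_sub_rev] at h6
    linarith [norm_le_norm_add_norm_sub' (fderiv ℝ G 0 v) (fderiv ℝ G (ν⁻¹ • μ) v)]
  have h7 : 0 ≤ 1 / ν * ‖v‖ := by positivity
  linarith
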